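/- arXiv:math/0402310 — 3 statements merged into one kernel-verified Lean document; each statement's English description precedes it below -/
import Mathlib

section
/- Let R be a commutative Noetherian ring, and let M and N be finitely generated R-modules such that N has finite injective dimension. Then for every integer i ≥ 0, dim_R Ext^i_R(M,N) + i ≤ dim R; that is, whenever Ext^i_R(M,N) ≠ 0 one has dim_R Ext^i_R(M,N) ≤ dim R - i. (This is the module case of Theorem 2.1(ii).) -/
/-!
Common definitions: Ext modules, dimension of a module (Krull dimension of its
support, in `WithBot ℕ∞`, with `⊥` for the zero module), projective/injective
dimension via the Ext-vanishing characterization, and cohomological dimension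
with respect to an ideal via local cohomology.
-/

open CategoryTheory TensorProduct

universe u

/-- The `i`-th Ext module `Ext^i_R(M, N)` of two `R`-modules. -/
noncomputable def extMod (R : Type u) [CommRing R] (i : ℕ) (M N : ModuleCat.{u} R) :
    ModuleCat.{u} R :=
  ((Ext R (ModuleCat.{u} R) i).obj (Opposite.op M)).obj N

/-- The dimension `dim_R M` of an `R`-module: the Krull dimension of its support
`Supp_R M ⊆ Spec R`, an element of `WithBot ℕ∞` which is `⊥ = -∞` for the zero module. -/
noncomputable def supportDim (R : Type u) [CommRing R] (M : Type u) [AddCommGroup M]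
    [Module R M] : WithBot ℕ∞ :=
  Order.krullDim (Module.support R M)

/-- `M` has projective dimension at most `n`: `Ext^{n+1}_R(M, N) = 0` for every `N`. -/
def projDimLE (R : Type u) [CommRing R] (M : ModuleCat.{u} R) (n : ℕ) : Prop :=
  ∀ N : ModuleCat.{u} R, Subsingleton (extMod R (n + 1) M N)

/-- The projective dimension `proj.dim_R M`, as an element of `WithBot ℕ∞`
(it is `⊤` when `M` does not have finite projective dimension). -/
noncomputable def projDim (R : Type u) [CommRing R] (M : ModuleCat.{u} R) : WithBot ℕ∞ :=
  sInf {d : WithBot ℕ∞ | ∃ n : ℕ, d = n ∧ projDimLE R M n}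

/-- `N` has injective dimension at most `n`: `Ext^{n+1}_R(M, N) = 0` for every `M`. -/
def injDimLE (R : Type u) [CommRing R] (N : ModuleCat.{u} R) (n : ℕ) : Prop :=
  ∀ M : ModuleCat.{u} R, Subsingleton (extMod R (n + 1) M N)

/-- The cohomological dimension `cd(a, M)`: the supremum of those `i` with
`H^i_a(M) ≠ 0`, an element of `WithBot ℕ∞` which is `⊥ = -∞` when all the local
cohomology modules vanish. -/
noncomputable def cohDim (R : Type u) [CommRing R] (a : Ideal R) (M : ModuleCat.{u} R) :
    WithBot ℕ∞ :=
  ⨆ i ∈ {i : ℕ | ¬ Subsingleton ((localCohomology a i).obj M)}, (i : WithBot ℕ∞)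

/-- If a nonzero finite module `M` of dimension at most `n` over a Noetherian local ring has finite
projective dimension, then the residue field maps nontrivially to some finite module whose
projective dimension grew by at most `n`. -/
theorem exists_hom_residueField_ne_zero {A : Type u} [CommRing A] [IsNoetherianRing A]
    [IsLocalRing A] (n j : ℕ) (M : ModuleCat.{u} A) [Module.Finite A M] [Nontrivial M]
    (hdim : Module.supportDim A M ≤ n) (hpd : HasProjectiveDimensionLT M (j + 1)) :
    ∃ (Q : ModuleCat.{u} A) (f : (A ⧸ IsLocalRing.maximalIdeal A) →ₗ[A] Q),
      Module.Finite A Q ∧ f ≠ 0 ∧ HasProjectiveDimensionLT Q (j + n + 1) := by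
  by_cases h : Subsingleton ((A ⧸ IsLocalRing.maximalIdeal A) →ₗ[A] M)
  · obtain ⟨x, hx, hreg⟩ := IsSMulRegular.subsingleton_linearMap_iff.mp h
    rw [Ideal.annihilator_quotient] at hx
    have hnt : Nontrivial (QuotSMulTop x M) := nontrivial_quotSMulTop_of_mem_maximalIdeal M hx
    rw [← Module.supportDim_quotSMulTop_succ_eq_supportDim hreg hx] at hdim
    cases n with
    | zero =>
      rw [CharP.cast_eq_zero, ENat.WithBot.add_one_le_zero_iff] at hdim
      exact absurd hdim (Module.supportDim_ne_bot_of_nontrivial A _)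
    | succ n =>
      have hpd' : HasProjectiveDimensionLT (ModuleCat.of A (QuotSMulTop x M)) (j + 1 + 1) :=
        hreg.smulShortComplex_shortExact.hasProjectiveDimensionLT_X₃ (j + 1) hpd
          (hasProjectiveDimensionLT_of_ge M (j + 1) (j + 2) (Nat.le_add_right _ 1))
      rw [Nat.cast_succ, ← Nat.cast_one, ENat.WithBot.add_le_add_natCast_right_iff] at hdim
      obtain ⟨Q, f, hQ, hf, hp⟩ := exists_hom_residueField_ne_zero n (j + 1)
        (ModuleCat.of A (QuotSMulTop x M)) hdim hpd'
      exact ⟨Q, f, hQ, hf, by convert hp using 1; ring⟩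
  · rw [not_subsingleton_iff_nontrivial] at h
    obtain ⟨f, hf⟩ := exists_ne (0 : (A ⧸ IsLocalRing.maximalIdeal A) →ₗ[A] M)
    exact ⟨M, f, inferInstance, hf, hasProjectiveDimensionLT_of_ge M (j + 1) _ (by omega)⟩

theorem subsingleton_ext_of_shortExact {C : Type*} [Category C] [Abelian C] [HasExt C]
    {S : ShortComplex C} (hS : S.ShortExact) (N : C) (i : ℕ)
    (h₁ : Subsingleton (Abelian.Ext S.X₁ N i)) (h₃ : Subsingleton (Abelian.Ext S.X₃ N i)) :
    Subsingleton (Abelian.Ext S.X₂ N i) := by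
  refine subsingleton_of_forall_eq 0 fun x ↦ ?_
  obtain ⟨y, rfl⟩ := Abelian.Ext.contravariant_sequence_exact₂ hS N x (Subsingleton.elim _ _)
  rw [Subsingleton.elim y 0, Abelian.Ext.comp_zero]

/-- If `Ext Z N (i + 1)` vanishes for all quotients `Z` of `Y`, classes on a subobject `X` of `Y`
extend to `Y`. -/
theorem ext_precomp_surjective_of_mono {C : Type*} [Category C] [Abelian C] [HasExt C]
    {X Y N : C} (f : X ⟶ Y) [Mono f] (i : ℕ)
    (h : ∀ (Z : C) (g : Y ⟶ Z) [Epi g], Subsingleton (Abelian.Ext Z N (i + 1)))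
    (x : Abelian.Ext X N i) :
    ∃ y : Abelian.Ext Y N i, (Abelian.Ext.mk₀ f).comp y (zero_add i) = x := by
  have hS : (ShortComplex.mk f (Limits.cokernel.π f) (Limits.cokernel.condition f)).ShortExact :=
    { exact := ShortComplex.exact_cokernel f }
  have := h _ (Limits.cokernel.π f)
  exact Abelian.Ext.contravariant_sequence_exact₁ hS N x (add_comm 1 i) (Subsingleton.elim _ _)

/-- Vanishing of `Ext M N i` for finite `M` can be tested on the modules `A ⧸ q` with `q` prime. -/
theorem subsingleton_ext_of_finite_of_quotient {A : Type u} [CommRing A] [IsNoetherianRing A]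
    (N : ModuleCat.{u} A) (i : ℕ)
    (h : ∀ (M : ModuleCat.{u} A) (q : PrimeSpectrum A), (M ≃ₗ[A] A ⧸ q.1) →
      Subsingleton (Abelian.Ext M N i)) (M : ModuleCat.{u} A) [Module.Finite A M] :
    Subsingleton (Abelian.Ext M N i) := by
  suffices ∀ (P : Type u) [AddCommGroup P] [Module A P] [Module.Finite A P],
    Subsingleton (Abelian.Ext (ModuleCat.of A P) N i) from this M
  intro P _ _ hP
  induction hP using IsNoetherianRing.induction_on_isQuotientEquivQuotientPrime A with
  | subsingleton P =>
    have := (ModuleCat.isZero_of_subsingleton (ModuleCat.of A P)).hasProjectiveDimensionLT_zero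
    exact this.subsingleton _ 0 i (Nat.zero_le i) N
  | quotient P q e => exact h (ModuleCat.of A P) q e
  | exact P₁ P₂ P₃ f g hf hg hfg h₁ h₃ =>
    let S : ShortComplex (ModuleCat.{u} A) :=
      ModuleCat.shortComplexOfCompEqZero f g hfg.linearMap_comp_eq_zero
    exact subsingleton_ext_of_shortExact (ModuleCat.shortComplex_shortExact S hfg hf hg) N i h₁ h₃

/-- Over a Noetherian local ring `A`, if `M` and `N` are finite and `N` has finite injective
dimension, then `Ext M N i` vanishes for `i > dim A`. -/
theorem subsingleton_ext_of_ringKrullDim_lt {A : Type u} [CommRing A] [IsNoetherianRing A]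
    [IsLocalRing A] (M N : ModuleCat.{u} A) [Module.Finite A M] [Module.Finite A N]
    (n : ℕ) (hN : HasInjectiveDimensionLT N n) (i : ℕ) (hi : ringKrullDim A < i) :
    Subsingleton (Abelian.Ext M N i) := by
  by_cases hin : n ≤ i
  · exact hN.subsingleton _ n i hin M
  have ih (M' : ModuleCat.{u} A) [Module.Finite A M'] : Subsingleton (Abelian.Ext M' N (i + 1)) :=
    subsingleton_ext_of_ringKrullDim_lt M' N n hN (i + 1) (hi.trans (by
      exact_mod_cast Nat.lt_succ_self i))
  refine subsingleton_ext_of_finite_of_quotient N i (fun M q e ↦ ?_) M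
  have hMfin : Module.Finite A M := .equiv e.symm
  have ihq (Y : ModuleCat.{u} A) [Module.Finite A Y] (Z : ModuleCat.{u} A) (g : Y ⟶ Z) [Epi g] :
      Subsingleton (Abelian.Ext Z N (i + 1)) :=
    have : Module.Finite A Z := .of_surjective g.hom ((ModuleCat.epi_iff_surjective g).mp ‹_›)
    ih Z
  by_cases hq : q.1 = IsLocalRing.maximalIdeal A
  · obtain ⟨d, hd⟩ : ∃ d : ℕ, ringKrullDim A = d := by
      obtain ⟨h₁, h₂⟩ := finiteRingKrullDim_iff_ne_bot_and_top.mp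
        (inferInstance : FiniteRingKrullDim A)
      lift ringKrullDim A to ℕ∞ using h₁ with d
      lift d to ℕ using fun h ↦ h₂ (by rw [h]; rfl)
      exact ⟨d, rfl⟩
    obtain ⟨Q, f, hQ, hf, hp⟩ := exists_hom_residueField_ne_zero d 0 (ModuleCat.of A A)
      (by simp [Module.supportDim_self_eq_ringKrullDim, hd]) inferInstance
    have hinj : Function.Injective f := by
      have : IsSimpleModule A (A ⧸ IsLocalRing.maximalIdeal A) :=
        isSimpleModule_iff_isCoatom.mpr (Ideal.isMaximal_def.mp inferInstance)
      exact f.injective_of_ne_zero hf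
    have hQi : Subsingleton (Abelian.Ext Q N i) := hp.subsingleton _ _ i (by
      rw [hd] at hi
      have : d < i := by exact_mod_cast hi
      omega) N
    let g : M ⟶ Q := ModuleCat.ofHom
      (f ∘ₗ (Submodule.quotEquivOfEq _ _ hq).toLinearMap ∘ₗ e.toLinearMap)
    have : Mono g := (ModuleCat.mono_iff_injective _).mpr
      (hinj.comp ((Submodule.quotEquivOfEq _ _ hq).injective.comp e.injective))
    refine subsingleton_of_forall_eq 0 fun x ↦ ?_
    obtain ⟨y, rfl⟩ := ext_precomp_surjective_of_mono g i (ihq Q) x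
    rw [Subsingleton.elim y 0, Abelian.Ext.comp_zero]
  · obtain ⟨x, hx, hxq⟩ := SetLike.exists_of_lt
      (lt_of_le_of_ne (IsLocalRing.le_maximalIdeal q.2.ne_top) hq)
    have hmono : Mono (x • 𝟙 M) := by
      refine (ModuleCat.mono_iff_injective _).mpr ?_
      intro a b hab
      have hab' : x • a = x • b := hab
      have he : x • (e a - e b) = 0 := by
        rw [← map_sub, ← map_smul, smul_sub, hab', sub_self, map_zero]
      rw [Algebra.smul_def, mul_eq_zero] at he
      rcases he with he | he
      · exact absurd (Ideal.Quotient.eq_zero_iff_mem.mp he) hxq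
      · exact e.injective (sub_eq_zero.mp he)
    have htop : (⊤ : Submodule A (Abelian.Ext M N i)) ≤ IsLocalRing.maximalIdeal A • ⊤ := by
      intro y _
      obtain ⟨z, rfl⟩ := ext_precomp_surjective_of_mono (x • 𝟙 M) i (ihq M) y
      rw [Abelian.Ext.mk₀_smul, Abelian.Ext.smul_comp, Abelian.Ext.mk₀_id_comp]
      exact Submodule.smul_mem_smul hx trivial
    have := Submodule.eq_bot_of_le_smul_of_le_jacobson_bot _ ⊤ Module.Finite.fg_top htop
      (IsLocalRing.maximalIdeal_le_jacobson _)
    exact (Submodule.subsingleton_iff A).mp (subsingleton_of_bot_eq_top this.symm)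
termination_by n - i

theorem ModuleCat.exists_smul_eq_zero_of_localizedModuleMap_eq_zero {R : Type u} [CommRing R]
    (S : Submonoid R) {M N : ModuleCat.{u} R} [Module.Finite R M] (f : M ⟶ N)
    (hf : ∀ m, N.localizedModuleMkLinearMap S (f m) = 0) : ∃ s ∈ S, s • f = 0 := by
  obtain ⟨s, hs⟩ := Module.Finite.exists_smul_of_comp_eq_of_isLocalizedModule S
    (N.localizedModuleMkLinearMap S) f.hom 0 (by ext m; simpa using hf m)
  refine ⟨s, s.2, ?_⟩
  ext m
  exact (LinearMap.congr_fun hs m).trans (smul_zero _)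

theorem ModuleCat.projective_localizedModule {R : Type u} [CommRing R] (S : Submonoid R)
    (P : ModuleCat.{u} R) [Module.Projective R P] : Projective (P.localizedModule S) := by
  have := Module.projective_of_isLocalizedModule (Rₛ := Localization S) S
    (P.localizedModuleMkLinearMap S)
  infer_instance

theorem ModuleCat.localizedModuleMap_apply_mk {R : Type u} [CommRing R]
    (S : Submonoid R) {M N : ModuleCat.{u} R} (f : M ⟶ N) (m : M) :
    ((ModuleCat.localizedModuleFunctor S).map f) (M.localizedModuleMkLinearMap S m) =
      N.localizedModuleMkLinearMap S (f m) :=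
  IsLocalizedModule.map_apply S (M.localizedModuleMkLinearMap S)
    (N.localizedModuleMkLinearMap S) f.hom m

theorem ModuleCat.exists_smul_eq_comp_of_localizedModuleFunctor_map_comp_eq {R : Type u}
    [CommRing R] [IsNoetherianRing R] (S : Submonoid R) {K P N : ModuleCat.{u} R}
    [Module.Finite R K] [Module.Finite R P] (f : K ⟶ P) (g : K ⟶ N)
    (h : P.localizedModule S ⟶ N.localizedModule S)
    (hgh : (ModuleCat.localizedModuleFunctor S).map f ≫ h =
      (ModuleCat.localizedModuleFunctor S).map g) :
    ∃ s ∈ S, ∃ w : P ⟶ N, s • g = f ≫ w := by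
  have : Module.FinitePresentation R P := Module.finitePresentation_of_finite R _
  obtain ⟨h', s, hs⟩ := Module.FinitePresentation.exists_lift_of_isLocalizedModule S
    (N.localizedModuleMkLinearMap S)
    ((h.hom.restrictScalars R) ∘ₗ (P.localizedModuleMkLinearMap S))
  obtain ⟨t, ht, htg⟩ := exists_smul_eq_zero_of_localizedModuleMap_eq_zero S
    ((s : R) • g - f ≫ ModuleCat.ofHom h') fun m ↦ by
      have h₁ : N.localizedModuleMkLinearMap S (h' (f m)) =
          (s : R) • h (P.localizedModuleMkLinearMap S (f m)) := LinearMap.congr_fun hs (f m)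
      have h₂ : h (((ModuleCat.localizedModuleFunctor S).map f)
          (K.localizedModuleMkLinearMap S m)) =
        ((ModuleCat.localizedModuleFunctor S).map g) (K.localizedModuleMkLinearMap S m) :=
          ConcreteCategory.congr_hom hgh (K.localizedModuleMkLinearMap S m)
      rw [localizedModuleMap_apply_mk, localizedModuleMap_apply_mk] at h₂
      rw [h₂] at h₁
      change N.localizedModuleMkLinearMap S ((s : R) • g m - h' (f m)) = 0
      rw [map_sub, map_smul, h₁, sub_self]
  refine ⟨t * s, S.mul_mem ht s.2, t • ModuleCat.ofHom h', ?_⟩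
  rw [smul_sub, sub_eq_zero] at htg
  rw [mul_smul, Linear.comp_smul, htg]

/-- An `Ext` class out of a finite module which vanishes after localizing at `S` is killed by an
element of `S`. -/
theorem ModuleCat.exists_smul_eq_zero_of_mapExactFunctor_eq_zero {R : Type u} [CommRing R]
    [IsNoetherianRing R] (S : Submonoid R) (M N : ModuleCat.{u} R) [Module.Finite R M]
    (i : ℕ) (x : Abelian.Ext M N i)
    (hx : x.mapExactFunctor (ModuleCat.localizedModuleFunctor S) = 0) : ∃ s ∈ S, s • x = 0 := by
  induction i generalizing M with
  | zero =>
    obtain ⟨f, rfl⟩ := Abelian.Ext.homEquiv₀.symm.surjective x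
    change (Abelian.Ext.mk₀ f).mapExactFunctor _ = 0 at hx
    rw [Abelian.Ext.mapExactFunctor_mk₀, Abelian.Ext.mk₀_eq_zero_iff] at hx
    obtain ⟨s, hs, h⟩ := exists_smul_eq_zero_of_localizedModuleMap_eq_zero S f fun m ↦ by
      rw [← localizedModuleMap_apply_mk, hx]; rfl
    refine ⟨s, hs, ?_⟩
    change s • Abelian.Ext.mk₀ f = 0
    rw [← Abelian.Ext.mk₀_smul, h, Abelian.Ext.mk₀_zero]
  | succ i ih =>
    obtain ⟨P, _, _, _, _, f, hf⟩ := Module.exists_finite_presentation R M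
    have hT := LinearMap.shortExact_shortComplexKer hf
    set T := f.shortComplexKer
    have : Module.Finite R T.X₁ := inferInstanceAs (Module.Finite R (LinearMap.ker f))
    have : Module.Finite R T.X₂ := inferInstanceAs (Module.Finite R P)
    have : Module.Projective R T.X₂ := inferInstanceAs (Module.Projective R P)
    have hproj : Projective (T.X₂.localizedModule S) :=
      projective_localizedModule S T.X₂
    obtain ⟨y, rfl⟩ := precomp_extClass_surjective_of_projective_X₂ N hT i x
    change (hT.extClass.comp y (add_comm 1 i)).mapExactFunctor _ = 0 at hx
    rw [Abelian.Ext.mapExactFunctor_comp, Abelian.Ext.mapExactFunctor_extClass] at hx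
    obtain ⟨z, hz⟩ := Abelian.Ext.contravariant_sequence_exact₁
      (hT.map_of_exact (ModuleCat.localizedModuleFunctor S)) _ _ (add_comm 1 i) hx
    suffices ∃ s ∈ S, ∃ w : Abelian.Ext T.X₂ N i,
        s • y = (Abelian.Ext.mk₀ T.f).comp w (zero_add i) by
      obtain ⟨s, hs, w, hw⟩ := this
      refine ⟨s, hs, ?_⟩
      change s • hT.extClass.comp y (add_comm 1 i) = 0
      rw [← Abelian.Ext.comp_smul, hw]
      exact hT.extClass_comp_assoc _
    cases i with
    | zero =>
      obtain ⟨g, rfl⟩ := Abelian.Ext.homEquiv₀.symm.surjective y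
      obtain ⟨h, rfl⟩ := Abelian.Ext.homEquiv₀.symm.surjective z
      simp only [Abelian.Ext.homEquiv₀_symm_apply, Abelian.Ext.mapExactFunctor_mk₀,
        Abelian.Ext.mk₀_comp_mk₀] at hz ⊢
      have hgh := (Abelian.Ext.mk₀_bijective _ _).1 hz
      obtain ⟨s, hs, w, hw⟩ := exists_smul_eq_comp_of_localizedModuleFunctor_map_comp_eq S
        T.f g h hgh
      exact ⟨s, hs, Abelian.Ext.mk₀ w, by
        rw [Abelian.Ext.mk₀_comp_mk₀, ← Abelian.Ext.mk₀_smul, hw]⟩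
    | succ i =>
      have : Projective (T.map (ModuleCat.localizedModuleFunctor S)).X₂ := hproj
      rw [Abelian.Ext.eq_zero_of_projective z, Abelian.Ext.comp_zero] at hz
      obtain ⟨s, hs, h⟩ := ih T.X₁ y hz.symm
      exact ⟨s, hs, 0, by rw [h, Abelian.Ext.comp_zero]⟩

theorem CategoryTheory.ProjectiveResolution.smul_extMk {R : Type u} [CommRing R]
    {M N : ModuleCat.{u} R} (P : ProjectiveResolution M) {n : ℕ} (r : R)
    (f : P.complex.X n ⟶ N) (m : ℕ) (hm : n + 1 = m) (hf : P.complex.d m n ≫ f = 0) :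
    r • P.extMk f m hm hf = P.extMk (r • f) m hm (by rw [Linear.comp_smul, hf, smul_zero]) := by
  rw [Abelian.Ext.smul_eq_comp_mk₀, P.extMk_comp_mk₀]
  congr 1

/-- The linear map sending a cocycle of `Hom(P, N)` to its class in `Ext M N (n + 1)`. -/
noncomputable def CategoryTheory.ProjectiveResolution.extMkLinearMap {R : Type u} [CommRing R]
    {M : ModuleCat.{u} R} (P : ProjectiveResolution M) (N : ModuleCat.{u} R) (n : ℕ) :
    LinearMap.ker ((P.complex.linearYonedaObj R N).sc' n (n + 1) (n + 2)).g.hom →ₗ[R]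
      Abelian.Ext M N (n + 1) where
  toFun f := P.extMk (f.1 : P.complex.X (n + 1) ⟶ N) (n + 2) rfl f.2
  map_add' f g := (P.add_extMk _ _ _ rfl f.2 g.2).symm
  map_smul' r f :=
    (P.smul_extMk r _ (n + 2) rfl f.2).symm

theorem CategoryTheory.ProjectiveResolution.extMkLinearMap_surjective {R : Type u} [CommRing R]
    {M : ModuleCat.{u} R} (P : ProjectiveResolution M) (N : ModuleCat.{u} R) (n : ℕ) :
    Function.Surjective (P.extMkLinearMap N n) := fun x ↦ by
  obtain ⟨f, hf, rfl⟩ := P.extMk_surjective x (n + 2) rfl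
  exact ⟨⟨f, hf⟩, rfl⟩

theorem CategoryTheory.ProjectiveResolution.ker_extMkLinearMap {R : Type u} [CommRing R]
    {M : ModuleCat.{u} R} (P : ProjectiveResolution M) (N : ModuleCat.{u} R) (n : ℕ) :
    LinearMap.ker (P.extMkLinearMap N n) = LinearMap.range
      ((P.complex.linearYonedaObj R N).sc' n (n + 1) (n + 2)).moduleCatToCycles := by
  ext f
  refine (P.extMk_eq_zero_iff _ (n + 2) rfl f.2 n rfl).trans ?_
  exact ⟨fun ⟨g, hg⟩ ↦ ⟨g, Subtype.ext hg⟩, fun ⟨g, hg⟩ ↦ ⟨g, congrArg Subtype.val hg⟩⟩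

/-- The derived functor `Ext` and the derived category `Abelian.Ext` agree in positive degrees. -/
theorem nonempty_ext_linearEquiv {R : Type u} [CommRing R] (M N : ModuleCat.{u} R) (n : ℕ) :
    Nonempty (((Ext R (ModuleCat.{u} R) (n + 1)).obj (Opposite.op M)).obj N ≃ₗ[R]
      Abelian.Ext M N (n + 1)) := by
  let P := ProjectiveResolution.of M
  let e₁ := (P.isoExt (R := R) (n + 1) N ≪≫
    (P.complex.linearYonedaObj R N).homologyIsoSc' n (n + 1) (n + 2) (by simp) (by simp) ≪≫
    ShortComplex.moduleCatHomologyIso _).toLinearEquiv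
  exact ⟨e₁.trans ((Submodule.quotEquivOfEq _ _ (P.ker_extMkLinearMap N n).symm).trans
    (LinearMap.quotKerEquivOfSurjective _ (P.extMkLinearMap_surjective N n)))⟩

/-- Vanishing of `Ext M N n` for all `M` bounds the injective dimension of `N`. -/
theorem hasInjectiveDimensionLT_of_subsingleton_ext {R : Type u} [CommRing R]
    (N : ModuleCat.{u} R) (n : ℕ) (h : ∀ M : ModuleCat.{u} R, Subsingleton (Abelian.Ext M N n)) :
    HasInjectiveDimensionLT N n := by
  refine .mk fun i hi M x ↦ ?_
  induction i, hi using Nat.le_induction generalizing M with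
  | base => exact Subsingleton.elim _ _
  | succ i hi ih =>
    obtain ⟨y, rfl⟩ := precomp_extClass_surjective_of_projective_X₂ N
      M.shortExact_projectiveShortComplex i x
    rw [ih _ y, map_zero]

/-- If `N` has finite injective dimension, primes in the support of `Ext M N i` have height at
least `i`. -/
theorem le_height_of_mem_support_ext {R : Type u} [CommRing R] [IsNoetherianRing R]
    (M N : ModuleCat.{u} R) [Module.Finite R M] [Module.Finite R N] (n : ℕ)
    (hN : HasInjectiveDimensionLT N (n + 1)) (i : ℕ) (p : PrimeSpectrum R)
    (hp : p ∈ Module.support R (Abelian.Ext M N i)) : i ≤ Order.height p := by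
  by_contra! hlt
  rw [Module.mem_support_iff_exists_annihilator] at hp
  obtain ⟨x, hx⟩ := hp
  let S := p.asIdeal.primeCompl
  have : HasInjectiveDimensionLE N n := hN
  have hNS := N.localizedModule_hasInjectiveDimensionLE n S
  have : Module.Finite (Localization S) (M.localizedModule S) :=
    .of_isLocalizedModule S (M.localizedModuleMkLinearMap S)
  have : Module.Finite (Localization S) (N.localizedModule S) :=
    .of_isLocalizedModule S (N.localizedModuleMkLinearMap S)
  have hd : ringKrullDim (Localization S) < i := by
    have := IsLocalization.AtPrime.ringKrullDim_eq_height p.asIdeal (Localization S)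
    rw [this, PrimeSpectrum.height_eq_orderHeight]
    exact_mod_cast hlt
  have : IsNoetherianRing (Localization S) := IsLocalization.isNoetherianRing S _ inferInstance
  have : IsLocalRing (Localization S) := Localization.AtPrime.isLocalRing (P := p.asIdeal)
  have := subsingleton_ext_of_ringKrullDim_lt (M.localizedModule S) (N.localizedModule S)
    (n + 1) hNS i hd
  obtain ⟨s, hs, h⟩ := ModuleCat.exists_smul_eq_zero_of_mapExactFunctor_eq_zero S M N i x
    (Subsingleton.elim (α := Abelian.Ext (M.localizedModule S) (N.localizedModule S) i) _ _)
  exact hs (hx (by rw [Submodule.mem_annihilator_span_singleton]; exact h))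

/-- A subset all of whose elements have height at least `i` has codimension at least `i`. -/
theorem krullDim_add_le_of_le_height {α : Type*} [Preorder α] (s : Set α) (i : ℕ)
    (h : ∀ a ∈ s, i ≤ Order.height a) : Order.krullDim s + i ≤ Order.krullDim α := by
  rcases isEmpty_or_nonempty s with hs | hs
  · simp [Order.krullDim_eq_bot]
  have : Nonempty α := hs.map Subtype.val
  have key (q : LTSeries s) (k : ℕ) (hk : k < q.length + 1) :
      (k : ℕ∞) + i ≤ Order.height (q ⟨k, hk⟩ : α) := by
    induction k with
    | zero => simpa using h _ (q ⟨0, hk⟩).2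
    | succ k ih =>
      have hlt : (q ⟨k, by omega⟩ : α) < q ⟨k + 1, hk⟩ :=
        q.strictMono (Fin.mk_lt_mk.mpr (Nat.lt_succ_self k))
      calc ((k + 1 : ℕ) : ℕ∞) + i = k + i + 1 := by push_cast; ring
        _ ≤ Order.height (q ⟨k, by omega⟩ : α) + 1 := by gcongr; exact ih _
        _ ≤ _ := Order.height_add_one_le hlt
  rw [Order.krullDim_eq_iSup_length, Order.krullDim_eq_iSup_height_of_nonempty]
  norm_cast
  rw [ENat.iSup_add]
  exact iSup_le fun q ↦ (key q q.length (Nat.lt_succ_self _)).trans (le_iSup Order.height _)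

/-- Theorem 2.1(ii), module case: if `M`, `N` are finitely generated over a commutative
Noetherian ring `R` and `N` has finite injective dimension, then
`dim_R Ext^i_R(M, N) + i ≤ dim R` for every `i`. -/
theorem dim_ext_add_le_of_finite_injDim (R : Type u) [CommRing R] [IsNoetherianRing R]
    (M N : ModuleCat.{u} R) [Module.Finite R M] [Module.Finite R N]
    (hid : ∃ n : ℕ, injDimLE R N n) (i : ℕ) :
    supportDim R (extMod R i M N) + (i : WithBot ℕ∞) ≤ ringKrullDim R := by
  obtain ⟨n, hn⟩ := hid
  have hN : HasInjectiveDimensionLT N (n + 1) :=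
    hasInjectiveDimensionLT_of_subsingleton_ext N (n + 1) fun L ↦
      have : Subsingleton (((Ext R (ModuleCat.{u} R) (n + 1)).obj (Opposite.op L)).obj N) := hn L
      (nonempty_ext_linearEquiv L N n).some.symm.injective.subsingleton
  refine krullDim_add_le_of_le_height _ i fun p hp ↦ ?_
  cases i with
  | zero => simp
  | succ i =>
    rw [extMod, (nonempty_ext_linearEquiv M N i).some.support_eq] at hp
    exact le_height_of_mem_support_ext M N n hN (i + 1) p hp
end

section
/- Let (R,m,k) be a commutative Noetherian local ring. Then R is Gorenstein if and only if there exists an n ∈ ℕ such that Ext^i_R(k,R) = 0 for all i > n (equivalently, dim RHom_R(k,R) = sup over i of (dim_R Ext^i_R(k,R) + i) is not +∞). (Corollary 2.3, equivalence of (i) and (iv).) -/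
/-!
Common definitions: Ext modules, dimension of a module (Krull dimension of its
support, in `WithBot ℕ∞`, with `⊥` for the zero module), projective/injective
dimension via the Ext-vanishing characterization, and cohomological dimension
with respect to an ideal via local cohomology.
-/

open CategoryTheory TensorProduct

universe u

/-- The depth of a Noetherian local ring `R`: the least `i` with `Ext^i_R(k, R) ≠ 0`,
where `k` is the residue field. -/
noncomputable def ringDepth (R : Type u) [CommRing R] [IsLocalRing R] : ℕ :=
  sInf {i : ℕ |
    ¬ Subsingleton (extMod R i (ModuleCat.of R (IsLocalRing.ResidueField R)) (ModuleCat.of R R))}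

/-- A local ring is Gorenstein if `R` has finite injective dimension as a module
over itself. -/
def IsGorensteinLocalRing (R : Type u) [CommRing R] [IsLocalRing R] : Prop :=
  ∃ n : ℕ, injDimLE R (ModuleCat.of R R) n

/-- A local ring is Cohen–Macaulay if its depth equals its Krull dimension. -/
def IsCohenMacaulayLocalRing (R : Type u) [CommRing R] [IsLocalRing R] : Prop :=
  ringKrullDim R = (ringDepth R : WithBot ℕ∞)

/-- In positive degrees, the vanishing of the derived functor `extMod` agrees with the vanishing
of `Ext`-groups defined through the derived category. -/
lemma subsingleton_extMod_succ_iff {R : Type u} [CommRing R] (i : ℕ) (M N : ModuleCat.{u} R) :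
    Subsingleton (extMod R (i + 1) M N) ↔ Subsingleton (Abelian.Ext M N (i + 1)) := by
  let P : ProjectiveResolution M := projectiveResolution M
  have h_ext : Subsingleton (extMod R (i + 1) M N) ↔
      ∀ f : P.complex.X (i + 1) ⟶ N, P.complex.d (i + 2) (i + 1) ≫ f = 0 →
        ∃ g : P.complex.X i ⟶ N, P.complex.d (i + 1) i ≫ g = f := by
    rw [← ModuleCat.isZero_iff_subsingleton, extMod, (P.isoExt (i + 1) N).isZero_iff,
      ← HomologicalComplex.exactAt_iff_isZero_homology,
      HomologicalComplex.exactAt_iff' _ i (i + 1) (i + 2) (by simp) (by simp),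
      ShortComplex.moduleCat_exact_iff]
    rfl
  rw [h_ext]
  constructor
  · refine fun h ↦ subsingleton_of_forall_eq 0 fun e ↦ ?_
    obtain ⟨f, hf, rfl⟩ := P.extMk_surjective e (i + 2) rfl
    exact (P.extMk_eq_zero_iff f (i + 2) rfl hf i rfl).2 (h f hf)
  · intro _ f hf
    exact (P.extMk_eq_zero_iff f (i + 2) rfl hf i rfl).1 (Subsingleton.elim _ _)

namespace ModuleCat

variable {R : Type u} [CommRing R]

/-- A module `M` with `Ext^1(R ⧸ I, M) = 0` for every ideal `I` is injective. -/
lemma injective_of_subsingleton_ext_one (M : ModuleCat.{u} R)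
    (h : ∀ I : Ideal R, Subsingleton (Abelian.Ext (of R (R ⧸ I)) M 1)) : Injective M := by
  rw [← Module.injective_iff_injective_object]
  refine Module.Baer.injective fun I g ↦ ?_
  have hS : (shortComplexOfCompEqZero I.subtype I.mkQ
      (LinearMap.exact_subtype_mkQ I).linearMap_comp_eq_zero).ShortExact :=
    shortComplex_shortExact _ (LinearMap.exact_subtype_mkQ I) I.injective_subtype
      I.mkQ_surjective
  obtain ⟨φ, hφ⟩ := Abelian.Ext.contravariant_sequence_exact₁ hS M
    (Abelian.Ext.mk₀ (ofHom g)) (zero_add 1) (@Subsingleton.elim _ (h I) _ _)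
  obtain ⟨φ, rfl⟩ := Abelian.Ext.homEquiv₀.symm.surjective φ
  have h_comp : ofHom I.subtype ≫ φ = ofHom g :=
    Abelian.Ext.homEquiv₀.symm.injective (by simpa using hφ)
  exact ⟨φ.hom, fun x hx ↦ DFunLike.congr_fun (congrArg Hom.hom h_comp) ⟨x, hx⟩⟩

/-- A module `M` with `Ext^{n+1}(R ⧸ I, M) = 0` for every ideal `I` has injective dimension
at most `n`. -/
lemma hasInjectiveDimensionLE_of_subsingleton_ext (n : ℕ) (M : ModuleCat.{u} R)
    (h : ∀ I : Ideal R, Subsingleton (Abelian.Ext (of R (R ⧸ I)) M (n + 1))) :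
    HasInjectiveDimensionLE M n := by
  induction n generalizing M with
  | zero =>
    exact injective_iff_hasInjectiveDimensionLT_one.1 (injective_of_subsingleton_ext_one M h)
  | succ n ih =>
    obtain ⟨J, _, f, _⟩ := EnoughInjectives.presentation M
    have hS : (ShortComplex.mk f (Limits.cokernel.π f) (Limits.cokernel.condition f)).ShortExact :=
      { exact := ShortComplex.exact_cokernel f }
    refine (hS.hasInjectiveDimensionLT_X₃_iff n ‹_›).1 (ih _ fun I ↦ ?_)
    refine subsingleton_of_forall_eq 0 fun e ↦ ?_
    obtain ⟨e', rfl⟩ := Abelian.Ext.covariant_sequence_exact₃ _ hS e rfl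
      (@Subsingleton.elim _ (h I) _ _)
    rw [e'.eq_zero_of_injective, Abelian.Ext.zero_comp]

/-- The vanishing of `Ext^i(-, M)` is stable under extensions. -/
lemma subsingleton_ext_X₂ {S : ShortComplex (ModuleCat.{u} R)} (hS : S.ShortExact)
    (M : ModuleCat.{u} R) (i : ℕ) (h₁ : Subsingleton (Abelian.Ext S.X₁ M i))
    (h₃ : Subsingleton (Abelian.Ext S.X₃ M i)) : Subsingleton (Abelian.Ext S.X₂ M i) := by
  refine subsingleton_of_forall_eq 0 fun e ↦ ?_
  obtain ⟨e', rfl⟩ := Abelian.Ext.contravariant_sequence_exact₂ hS M e (Subsingleton.elim _ _)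
  rw [Subsingleton.elim e' 0, Abelian.Ext.comp_zero]

/-- If `x ∈ m` is regular on `N` and `Ext^{i+1}(N ⧸ xN, M) = 0`, then `Ext^i(N, M) = 0` by
Nakayama's lemma. -/
lemma subsingleton_ext_of_isSMulRegular [IsNoetherianRing R] [IsLocalRing R]
    (N M : ModuleCat.{u} R) [Module.Finite R N] [Module.Finite R M] {x : R}
    (hx : x ∈ IsLocalRing.maximalIdeal R) (h_reg : IsSMulRegular N x) (i : ℕ)
    (h : Subsingleton (Abelian.Ext (N.smulShortComplex x).X₃ M (i + 1))) :
    Subsingleton (Abelian.Ext N M i) := by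
  have h_top : (⊤ : Submodule R (Abelian.Ext N M i)) ≤
      Ideal.span {x} • (⊤ : Submodule R (Abelian.Ext N M i)) := by
    intro e _
    obtain ⟨e', rfl⟩ := Abelian.Ext.contravariant_sequence_exact₁ h_reg.smulShortComplex_shortExact
      M e (add_comm 1 i) (Subsingleton.elim _ _)
    have h_smul (a : Abelian.Ext N M i) :
        (Abelian.Ext.mk₀ (x • 𝟙 N)).comp a (zero_add i) = x • a := by
      rw [Abelian.Ext.mk₀_smul, Abelian.Ext.smul_comp, Abelian.Ext.mk₀_id_comp]
    exact (h_smul e').symm ▸ Submodule.smul_mem_smul (Ideal.mem_span_singleton_self x) trivial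
  have h_bot := Submodule.eq_bot_of_le_smul_of_le_jacobson_bot _ _ Module.Finite.fg_top h_top
    (by rwa [IsLocalRing.jacobson_eq_maximalIdeal ⊥ bot_ne_top, Ideal.span_singleton_le_iff_mem])
  exact (Submodule.subsingleton_iff R).1 (subsingleton_of_bot_eq_top h_bot.symm)

open scoped Pointwise in
/-- If `Ext^i(k, M) = 0` for all `i > n`, where `k` is the residue field, then `Ext^i(N, M) = 0`
for all `i > n` and every finitely generated module `N`. -/
lemma subsingleton_ext_of_residueField [IsNoetherianRing R] [IsLocalRing R]
    (M : ModuleCat.{u} R) [Module.Finite R M] (n : ℕ)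
    (h : ∀ i, n < i → Subsingleton (Abelian.Ext (of R (IsLocalRing.ResidueField R)) M i))
    (N : Type u) [AddCommGroup N] [Module R N] [Module.Finite R N] (i : ℕ) (hi : n < i) :
    Subsingleton (Abelian.Ext (of R N) M i) := by
  suffices H : ∀ (J : Ideal R) (N : Type u) [AddCommGroup N] [Module R N] [Module.Finite R N],
      J ≤ Module.annihilator R N → ∀ i, n < i → Subsingleton (Abelian.Ext (of R N) M i) from
    H ⊥ N bot_le i hi
  clear! N i
  intro J
  induction J using WellFoundedGT.induction with
  | ind J ih =>
  intro N _ _ h_fin hJ i hi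
  induction h_fin using IsNoetherianRing.induction_on_isQuotientEquivQuotientPrime R with
  | subsingleton N =>
    refine subsingleton_of_forall_eq 0 fun e ↦ ?_
    rw [← e.mk₀_id_comp, (isZero_of_subsingleton (of R N)).eq_zero_of_src (𝟙 _),
      Abelian.Ext.mk₀_zero, Abelian.Ext.zero_comp]
  | quotient N p f =>
    have h_ann : Module.annihilator R N = p.1 := by
      rw [f.annihilator_eq, Ideal.annihilator_quotient]
    rw [h_ann] at hJ
    obtain hJ | rfl := hJ.lt_or_eq
    · exact ih _ hJ N h_ann.ge i hi
    by_cases hp : p.1 = IsLocalRing.maximalIdeal R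
    · have := h i hi
      let e : of R N ≅ of R (IsLocalRing.ResidueField R) :=
        (f.trans (Submodule.quotEquivOfEq _ _ hp)).toModuleIso
      refine subsingleton_of_forall_eq 0 fun a ↦ ?_
      rw [← a.mk₀_id_comp, ← e.hom_inv_id, ← Abelian.Ext.mk₀_comp_mk₀_assoc,
        Subsingleton.elim ((Abelian.Ext.mk₀ e.inv).comp a _) 0, Abelian.Ext.comp_zero]
    obtain ⟨x, hx, hxp⟩ := SetLike.exists_of_lt
      ((IsLocalRing.le_maximalIdeal p.2.ne_top).lt_of_ne hp)
    have h_reg : IsSMulRegular N x := by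
      rw [f.isSMulRegular_congr]
      refine IsSMulRegular.of_right_eq_zero_of_smul fun y hy ↦ ?_
      obtain ⟨y, rfl⟩ := Ideal.Quotient.mk_surjective y
      rw [Algebra.smul_def, Ideal.Quotient.algebraMap_eq, ← map_mul,
        Ideal.Quotient.eq_zero_iff_mem] at hy
      exact Ideal.Quotient.eq_zero_iff_mem.2 ((p.2.mem_or_mem hy).resolve_left hxp)
    refine subsingleton_ext_of_isSMulRegular (of R N) M hx h_reg i
      (ih (p.1 ⊔ Ideal.span {x}) ?_ (N ⧸ x • (⊤ : Submodule R N)) ?_ (i + 1) (by lia))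
    · exact left_lt_sup.2 (by rwa [Ideal.span_singleton_le_iff_mem])
    · refine sup_le (h_ann.ge.trans
        (LinearMap.annihilator_le_of_surjective _ (Submodule.mkQ_surjective _))) ?_
      rw [Ideal.span_singleton_le_iff_mem, Module.mem_annihilator]
      intro y
      obtain ⟨y, rfl⟩ := Submodule.mkQ_surjective _ y
      rw [← map_smul, Submodule.mkQ_apply, Submodule.Quotient.mk_eq_zero]
      exact Submodule.smul_mem_pointwise_smul _ _ _ trivial
  | exact N₁ N₂ N₃ f g hf hg hfg ih₁ ih₃ =>
    exact subsingleton_ext_X₂ (S := shortComplexOfCompEqZero f g hfg.linearMap_comp_eq_zero)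
      (shortComplex_shortExact _ hfg hf hg) M i
      (ih₁ (hJ.trans (f.annihilator_le_of_injective hf)))
      (ih₃ (hJ.trans (g.annihilator_le_of_surjective hg)))

end ModuleCat

/-- Corollary 2.3, (i) ⇔ (iv): a commutative Noetherian local ring `R` is Gorenstein
iff there is an `n` with `Ext^i_R(k, R) = 0` for all `i > n`, where `k` is the
residue field. -/
theorem isGorensteinLocalRing_iff_ext_residueField_vanishes (R : Type u) [CommRing R]
    [IsNoetherianRing R] [IsLocalRing R] :
    IsGorensteinLocalRing R ↔
      ∃ n : ℕ, ∀ i : ℕ, n < i →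
        Subsingleton
          (extMod R i (ModuleCat.of R (IsLocalRing.ResidueField R)) (ModuleCat.of R R)) := by
  simp only [IsGorensteinLocalRing, injDimLE, subsingleton_extMod_succ_iff]
  refine exists_congr fun n ↦ ⟨fun h i hi ↦ ?_, fun h N ↦ ?_⟩
  · obtain ⟨i, rfl⟩ := Nat.exists_eq_succ_of_ne_zero (Nat.ne_zero_of_lt hi)
    have := hasInjectiveDimensionLT_of_enoughProjectives _ (n + 1) h
    exact (subsingleton_extMod_succ_iff i _ _).2
      (HasInjectiveDimensionLT.subsingleton _ (n + 1) (i + 1) hi _)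
  · have := ModuleCat.hasInjectiveDimensionLE_of_subsingleton_ext n (ModuleCat.of R R) fun I ↦
      ModuleCat.subsingleton_ext_of_residueField (ModuleCat.of R R) n (fun i hi ↦ by
        obtain ⟨i, rfl⟩ := Nat.exists_eq_succ_of_ne_zero (Nat.ne_zero_of_lt hi)
        exact (subsingleton_extMod_succ_iff i _ _).1 (h _ hi)) (R ⧸ I) (n + 1) n.lt_succ_self
    exact HasInjectiveDimensionLT.subsingleton _ (n + 1) (n + 1) le_rfl N
end

section
/- Let R be a commutative Noetherian ring, and let M and N be finitely generated R-modules such that M has finite projective dimension. Then for every integer i ≥ 0, dim_R Ext^i_R(M,N) + i ≤ dim_R (M ⊗_R N) + proj.dim_R M. (Right-hand inequality of Theorem 2.6(ii)/Corollary 2.7 for modules: dim RHom_R(M,N) ≤ dim(M ⊗^L_R N) + proj.dim M.) -/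
/-!
Common definitions: Ext modules, dimension of a module (Krull dimension of its
support, in `WithBot ℕ∞`, with `⊥` for the zero module), projective/injective
dimension via the Ext-vanishing characterization, and cohomological dimension
with respect to an ideal via local cohomology.
-/

open CategoryTheory TensorProduct

universe u

theorem CategoryTheory.ShortComplex.smul_homology_eq_zero {R : Type u} [CommRing R]
    (S : ShortComplex (ModuleCat.{u} R)) (r : R)
    (h : ∀ x : S.X₂, S.g x = 0 → ∃ y : S.X₁, S.f y = r • x) (z : S.homology) : r • z = 0 := by
  obtain ⟨x, rfl⟩ := (ModuleCat.epi_iff_surjective S.homologyπ).1 inferInstance z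
  have hx : S.g (S.iCycles x) = 0 := by
    rw [← ModuleCat.comp_apply, S.iCycles_g]; rfl
  obtain ⟨y, hy⟩ := h _ hx
  have hxy : S.toCycles y = r • x := by
    apply (ModuleCat.mono_iff_injective S.iCycles).1 inferInstance
    rw [← ModuleCat.comp_apply, S.toCycles_i, hy, map_smul]
  rw [← map_smul, ← hxy, ← ModuleCat.comp_apply, S.toCycles_comp_homologyπ]
  rfl

theorem smul_extMod_eq_zero {R : Type u} [CommRing R] {M : ModuleCat.{u} R}
    (P : ProjectiveResolution M) (N : ModuleCat.{u} R) (n : ℕ) (r : R)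
    (h : ∀ φ : P.complex.X n ⟶ N, P.complex.d (n + 1) n ≫ φ = 0 →
      ∃ ψ : P.complex.X ((ComplexShape.up ℕ).prev n) ⟶ N,
        P.complex.d n ((ComplexShape.up ℕ).prev n) ≫ ψ = r • φ)
    (z : extMod R n M N) : r • z = 0 := by
  let K := P.complex.linearYonedaObj R N
  let e : extMod R n M N ≅ (K.sc' _ n (n + 1)).homology :=
    P.isoExt n N ≪≫ K.homologyIsoSc' _ n (n + 1) rfl (by simp)
  apply e.toLinearEquiv.injective
  rw [map_smul, map_zero]
  exact ShortComplex.smul_homology_eq_zero _ r h _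

theorem subsingleton_extMod_succ_iff_s9 {R : Type u} [CommRing R] {M : ModuleCat.{u} R}
    (P : ProjectiveResolution M) (N : ModuleCat.{u} R) (n : ℕ) :
    Subsingleton (extMod R (n + 1) M N) ↔
      ∀ φ : P.complex.X (n + 1) ⟶ N, P.complex.d (n + 2) (n + 1) ≫ φ = 0 →
        ∃ ψ : P.complex.X n ⟶ N, P.complex.d (n + 1) n ≫ ψ = φ := by
  let K := P.complex.linearYonedaObj R N
  let e : extMod R (n + 1) M N ≅ K.homology (n + 1) := P.isoExt (n + 1) N
  rw [e.toLinearEquiv.toEquiv.subsingleton_congr, ← ModuleCat.isZero_iff_subsingleton,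
    ← HomologicalComplex.exactAt_iff_isZero_homology,
    K.exactAt_iff' n (n + 1) (n + 2) (by simp) (by simp), ShortComplex.moduleCat_exact_iff]
  rfl

theorem projDimLE.succ {R : Type u} [CommRing R] {M : ModuleCat.{u} R} {n : ℕ}
    (h : projDimLE R M n) : projDimLE R M (n + 1) := by
  intro N
  let P := projectiveResolution M
  let d (k : ℕ) : P.complex.X (k + 1) ⟶ P.complex.X k := P.complex.d (k + 1) k
  have hd (k : ℕ) : d (k + 1) ≫ d k = 0 := P.complex.d_comp_d _ _ _
  have lift (k m : ℕ) (f : P.complex.X m ⟶ P.complex.X (k + 1)) (hf : f ≫ d k = 0) :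
      ∃ g : P.complex.X m ⟶ P.complex.X (k + 2), g ≫ d (k + 1) = f :=
    ⟨(P.exact_succ k).liftFromProjective f hf, (P.exact_succ k).liftFromProjective_comp _ _⟩
  obtain ⟨ψ, hψ⟩ := (subsingleton_extMod_succ_iff_s9 P _ n).1 (h (Limits.image (d n)))
    (Limits.factorThruImage (d n)) (by
      rw [← cancel_mono (Limits.image.ι (d n)), Category.assoc, Limits.image.fac]
      simpa using hd n)
  let σ : P.complex.X n ⟶ P.complex.X (n + 1) :=
    Projective.factorThru ψ (Limits.factorThruImage (d n))
  have hσ : d n ≫ σ ≫ d n = d n := by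
    have : σ ≫ d n = ψ ≫ Limits.image.ι (d n) := by
      rw [← Projective.factorThru_comp ψ (Limits.factorThruImage (d n)), Category.assoc,
        Limits.image.fac]
    rw [this, reassoc_of% hψ, Limits.image.fac]
  obtain ⟨t, ht⟩ := lift n _ (𝟙 _ - d n ≫ σ) (by simp [hσ])
  obtain ⟨u, hu⟩ := lift (n + 1) _ (𝟙 _ - d (n + 1) ≫ t) (by
    simp [ht, reassoc_of% hd n])
  refine (subsingleton_extMod_succ_iff_s9 P N (n + 1)).2 fun φ hφ => ⟨t ≫ φ, ?_⟩
  have : (𝟙 _ - d (n + 1) ≫ t) ≫ φ = 0 := by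
    rw [← hu, Category.assoc]
    exact (congrArg (u ≫ ·) hφ).trans Limits.comp_zero
  rw [Preadditive.sub_comp, Category.id_comp, Category.assoc, sub_eq_zero] at this
  exact this.symm

theorem projDimLE.mono {R : Type u} [CommRing R] {M : ModuleCat.{u} R} {m n : ℕ}
    (hmn : m ≤ n) (h : projDimLE R M m) : projDimLE R M n :=
  Nat.le_induction h (fun _ _ => projDimLE.succ) n hmn

theorem le_projDim_of_nontrivial_extMod {R : Type u} [CommRing R] {M N : ModuleCat.{u} R} {i : ℕ}
    (h : Nontrivial (extMod R i M N)) : (i : WithBot ℕ∞) ≤ projDim R M := by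
  refine le_sInf ?_
  rintro _ ⟨n, rfl, hn⟩
  by_contra! hlt
  obtain ⟨k, rfl⟩ := Nat.exists_eq_add_of_lt (show n < i by exact_mod_cast hlt)
  exact not_subsingleton _ (hn.mono (Nat.le_add_right n k) N)

theorem annihilator_right_le_annihilator_extMod {R : Type u} [CommRing R] (M N : ModuleCat.{u} R)
    (i : ℕ) : Module.annihilator R N ≤ Module.annihilator R (extMod R i M N) := by
  intro r hr
  rw [Module.mem_annihilator] at hr ⊢
  refine smul_extMod_eq_zero (projectiveResolution M) N i r fun φ _ => ⟨0, ?_⟩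
  rw [Limits.comp_zero]
  ext x
  exact (hr _).symm

theorem annihilator_left_le_annihilator_extMod {R : Type u} [CommRing R] (M N : ModuleCat.{u} R)
    (i : ℕ) : Module.annihilator R M ≤ Module.annihilator R (extMod R i M N) := by
  intro r hr
  rw [Module.mem_annihilator] at hr ⊢
  let P := projectiveResolution M
  have hM : r • 𝟙 M = 0 := by ext x; exact hr x
  have hP : (r • 𝟙 P.complex) ≫ P.π = 0 := by
    rw [Linear.smul_comp, Category.id_comp]
    apply HomologicalComplex.to_single_hom_ext
    change r • P.π.f 0 = 0
    ext x
    exact hr _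
  let H := ProjectiveResolution.liftHomotopyZero (r • 𝟙 P.complex) hP
  refine smul_extMod_eq_zero P N i r fun φ hφ => ⟨H.hom _ _ ≫ φ, ?_⟩
  have hc := H.comm i
  rw [prevD_eq _ (show (ComplexShape.down ℕ).Rel (i + 1) i by simp)] at hc
  have := congrArg (· ≫ φ) hc
  simp only [dNext, HomologicalComplex.smul_f_apply, HomologicalComplex.id_f,
    HomologicalComplex.zero_f, add_zero, Linear.smul_comp, Category.id_comp,
    Preadditive.add_comp, Category.assoc, hφ, Limits.comp_zero] at this
  exact this.symm

theorem support_inter_support_subset_support_tensorProduct {R : Type u} [CommRing R]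
    (M N : Type u) [AddCommGroup M] [Module R M] [AddCommGroup N] [Module R N]
    [Module.Finite R M] [Module.Finite R N] :
    Module.support R M ∩ Module.support R N ⊆ Module.support R (M ⊗[R] N) := by
  rintro p ⟨hM, hN⟩
  rw [Module.mem_support_iff_nontrivial_residueField_tensorProduct] at hM hN ⊢
  exact (AlgebraTensorModule.distribBaseChange R p.asIdeal.ResidueField M N).toEquiv.nontrivial

theorem support_extMod_subset {R : Type u} [CommRing R] (M N : ModuleCat.{u} R)
    [Module.Finite R M] [Module.Finite R N] (i : ℕ) :
    Module.support R (extMod R i M N) ⊆ Module.support R (M ⊗[R] N) := fun p hp => by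
  have h := Module.annihilator_le_of_mem_support hp
  exact support_inter_support_subset_support_tensorProduct M N
    ⟨Module.mem_support_iff_of_finite.2 ((annihilator_left_le_annihilator_extMod M N i).trans h),
      Module.mem_support_iff_of_finite.2 ((annihilator_right_le_annihilator_extMod M N i).trans h)⟩

/-- Theorem 2.6(ii), right-hand inequality / Corollary 2.7, module case: if `M`, `N`
are finitely generated modules over a commutative Noetherian ring `R` and `M` has
finite projective dimension, then
`dim_R Ext^i_R(M, N) + i ≤ dim_R (M ⊗_R N) + proj.dim_R M` for every `i`. -/
theorem dim_ext_add_le_dim_tensor_add_projDim (R : Type u) [CommRing R] [IsNoetherianRing R]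
    (M N : ModuleCat.{u} R) [Module.Finite R M] [Module.Finite R N]
    (hpd : ∃ n : ℕ, projDimLE R M n) (i : ℕ) :
    supportDim R (extMod R i M N) + (i : WithBot ℕ∞)
      ≤ supportDim R (M ⊗[R] N) + projDim R M := by
  rcases subsingleton_or_nontrivial (extMod R i M N) with h | h
  · have : IsEmpty (Module.support R (extMod R i M N)) := by
      rw [Module.support_eq_empty]; infer_instance
    simp only [supportDim, Order.krullDim_eq_bot, WithBot.bot_add, bot_le]
  · exact add_le_add
      (Order.krullDim_le_of_strictMono (Set.inclusion (support_extMod_subset M N i))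
        fun _ _ hab => hab)
      (le_projDim_of_nontrivial_extMod h)
end
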